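/- arXiv:1810.02088 — 2 statements merged into one kernel-verified Lean document; each statement's English description precedes it below -/
import Mathlib

section
/- Assume that for Lebesgue-a.e. x ∈ ℝ^n, 0 < ∫_ℝ f(x − μ) dμ < ∞ and ∫_ℝ |μ| f(x − μ) dμ < ∞, and that R₀ := ∫_{ℝ^n} μ̂₀(x)² f(x) dx < ∞, where μ̂₀(x) = (∫_ℝ μ f(x − μ) dμ)/(∫_ℝ f(x − μ) dμ). For each k ≥ 1 let φ_k(μ) = (1/k) φ(μ/k) be the N(0, k²) density, let δ_k(x) = (∫_ℝ μ f(x − μ) φ_k(μ) dμ)/(∫_ℝ f(x − μ) φ_k(μ) dμ) be the corresponding posterior mean, and let r_k = ∫_{ℝ^n} ∫_ℝ (δ_k(x) − μ)² f(x − μ) φ_k(μ) dμ dx be its Bayes risk. Then lim_{k→∞} r_k = R₀. -/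
open MeasureTheory ENNReal Filter Topology

/-- The standard normal density. -/
noncomputable def stdNormal (t : ℝ) : ℝ :=
  Real.exp (-(t ^ 2) / 2) / Real.sqrt (2 * Real.pi)

/-- The `N(0, k²)` density. -/
noncomputable def gaussPrior (k μ : ℝ) : ℝ := stdNormal (μ / k) / k

/-- The Pitman location estimator. -/
noncomputable def pitmanLoc (n : ℕ) (f : (Fin n → ℝ) → ℝ) (x : Fin n → ℝ) : ℝ :=
  (∫ μ : ℝ, μ * f (fun i => x i - μ)) / (∫ μ : ℝ, f (fun i => x i - μ))

/-- The posterior mean under the `N(0, k²)` prior. -/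
noncomputable def bayesLoc (n : ℕ) (f : (Fin n → ℝ) → ℝ) (k : ℝ) (x : Fin n → ℝ) : ℝ :=
  (∫ μ : ℝ, μ * f (fun i => x i - μ) * gaussPrior k μ) /
    (∫ μ : ℝ, f (fun i => x i - μ) * gaussPrior k μ)

theorem stdNormal_pos (t : ℝ) : 0 < stdNormal t := by
  unfold stdNormal; positivity

theorem stdNormal_eq_gaussianPDFReal : stdNormal = ProbabilityTheory.gaussianPDFReal 0 1 := by
  ext t
  simp [stdNormal, ProbabilityTheory.gaussianPDFReal, div_eq_inv_mul]

@[fun_prop]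
theorem continuous_stdNormal : Continuous stdNormal := by
  unfold stdNormal; fun_prop

theorem one_add_sq_mul_stdNormal_le (t : ℝ) : (1 + t ^ 2 / 2) * stdNormal t ≤ 1 := by
  have hexp : (1 + t ^ 2 / 2) * Real.exp (-(t ^ 2) / 2) ≤ 1 := by
    calc (1 + t ^ 2 / 2) * Real.exp (-(t ^ 2) / 2)
        ≤ Real.exp (t ^ 2 / 2) * Real.exp (-(t ^ 2) / 2) := by
          gcongr
          linarith [Real.add_one_le_exp (t ^ 2 / 2)]
      _ = 1 := by rw [← Real.exp_add]; simp [neg_div]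
  have hsqrt : 1 ≤ √(2 * Real.pi) := by
    rw [Real.one_le_sqrt]; linarith [Real.pi_gt_three]
  rw [stdNormal, ← mul_div_assoc]
  exact (div_le_one (by positivity)).2 (hexp.trans hsqrt)

theorem stdNormal_le_one (t : ℝ) : stdNormal t ≤ 1 := by
  nlinarith [one_add_sq_mul_stdNormal_le t, mul_nonneg (sq_nonneg t) (stdNormal_pos t).le]

theorem sq_mul_stdNormal_le_two (t : ℝ) : t ^ 2 * stdNormal t ≤ 2 := by
  nlinarith [one_add_sq_mul_stdNormal_le t, stdNormal_pos t]

theorem lintegral_stdNormal : ∫⁻ t, ENNReal.ofReal (stdNormal t) = 1 := by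
  rw [stdNormal_eq_gaussianPDFReal]
  exact ProbabilityTheory.lintegral_gaussianPDFReal_eq_one 0 one_ne_zero

theorem gaussPrior_pos {k : ℝ} (hk : 0 < k) (μ : ℝ) : 0 < gaussPrior k μ :=
  div_pos (stdNormal_pos _) hk

@[fun_prop]
theorem continuous_gaussPrior (k : ℝ) : Continuous (gaussPrior k) := by
  unfold gaussPrior; fun_prop

theorem lintegral_eq_ofReal_mul_lintegral_comp_mul_left {k : ℝ} (hk : 0 < k) {F : ℝ → ℝ≥0∞}
    (hF : Measurable F) : ∫⁻ μ, F μ = ∫⁻ t, ENNReal.ofReal k * F (k * t) := by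
  rw [lintegral_const_mul _ (by fun_prop),
    ← lintegral_map (f := F) (g := fun t => k * t) hF (by fun_prop)]
  conv_lhs => rw [← Real.smul_map_volume_mul_left hk.ne']
  rw [lintegral_smul_measure, abs_of_pos hk, smul_eq_mul]

theorem integrable_id_mul_of_abs_mul {h : ℝ → ℝ} (hh : AEStronglyMeasurable h)
    (hi : Integrable fun μ => |μ| * h μ) : Integrable fun μ => μ * h μ := by
  refine hi.mono (by fun_prop) (.of_forall fun μ => ?_)
  simp

theorem mean_translate {h : ℝ → ℝ} (hi : Integrable h) (hi1 : Integrable fun μ => μ * h μ)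
    (h0 : ∫ μ, h μ ≠ 0) (c : ℝ) :
    (∫ μ, μ * h (μ + c)) / (∫ μ, h (μ + c)) = (∫ μ, μ * h μ) / (∫ μ, h μ) - c := by
  have h1 : ∫ μ, μ * h (μ + c) = (∫ μ, μ * h μ) - c * ∫ μ, h μ := by
    rw [← integral_const_mul, ← integral_sub hi1 (hi.const_mul c),
      ← integral_add_right_eq_self (fun μ => μ * h μ - c * h μ) c]
    congr 1 with μ
    ring
  rw [h1, integral_add_right_eq_self h c, sub_div, mul_div_cancel_right₀ _ h0]

theorem integral_mul_pos {h g : ℝ → ℝ} (hh : ∀ μ, 0 ≤ h μ) (hpos : 0 < ∫ μ, h μ)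
    (hg : ∀ μ, 0 < g μ) (hi : Integrable h) (hi' : Integrable fun μ => h μ * g μ) :
    0 < ∫ μ, h μ * g μ := by
  rw [integral_pos_iff_support_of_nonneg (fun μ => mul_nonneg (hh μ) (hg μ).le) hi']
  rw [integral_pos_iff_support_of_nonneg hh hi] at hpos
  have : (Function.support fun μ => h μ * g μ) = Function.support h := by
    ext μ
    simp [(hg μ).ne']
  rwa [this]

theorem lintegral_sq_mean_sub_le {w : ℝ → ℝ} (hw : ∀ μ, 0 ≤ w μ) (hi : Integrable w)
    (hi1 : Integrable fun μ => μ * w μ) (hi2 : Integrable fun μ => μ ^ 2 * w μ)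
    (hpos : 0 < ∫ μ, w μ) (a : ℝ) :
    ∫⁻ μ, ENNReal.ofReal (((∫ ν, ν * w ν) / (∫ ν, w ν) - μ) ^ 2 * w μ) ≤
      ∫⁻ μ, ENNReal.ofReal ((a - μ) ^ 2 * w μ) := by
  have hexp (b : ℝ) : (fun μ => (b - μ) ^ 2 * w μ) =
      fun μ => b ^ 2 * w μ - 2 * b * (μ * w μ) + μ ^ 2 * w μ := by
    ext μ; ring
  have hint_sq (b : ℝ) : Integrable fun μ => (b - μ) ^ 2 * w μ := by
    rw [hexp]
    exact ((hi.const_mul _).sub (hi1.const_mul _)).add hi2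
  have hval (b : ℝ) : ∫ μ, (b - μ) ^ 2 * w μ =
      b ^ 2 * (∫ μ, w μ) - 2 * b * (∫ μ, μ * w μ) + ∫ μ, μ ^ 2 * w μ := by
    have hi01 : Integrable fun μ => b ^ 2 * w μ - 2 * b * (μ * w μ) :=
      (hi.const_mul _).sub (hi1.const_mul _)
    rw [hexp, integral_add hi01 hi2,
      integral_sub (hi.const_mul _) (hi1.const_mul _), integral_const_mul, integral_const_mul]
  have hnn (b : ℝ) : 0 ≤ᵐ[volume] fun μ => (b - μ) ^ 2 * w μ :=
    .of_forall fun μ => mul_nonneg (sq_nonneg _) (hw μ)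
  rw [← ofReal_integral_eq_lintegral_ofReal (hint_sq _) (hnn _),
    ← ofReal_integral_eq_lintegral_ofReal (hint_sq a) (hnn a), hval, hval]
  refine ENNReal.ofReal_le_ofReal ?_
  set m := (∫ ν, ν * w ν) / (∫ ν, w ν) with hm
  have hW : ∫ ν, ν * w ν = m * ∫ ν, w ν := by
    rw [hm, div_mul_cancel₀ _ hpos.ne']
  rw [hW]
  nlinarith [mul_nonneg hpos.le (sq_nonneg (a - m))]

theorem integrable_mul_stdNormal {h : ℝ → ℝ} (hi : Integrable h) (k t : ℝ) :
    Integrable fun μ => h μ * (stdNormal (μ / k + t) / k) := by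
  refine hi.mul_bdd (c := |k|⁻¹) (by fun_prop) (.of_forall fun μ => ?_)
  rw [Real.norm_eq_abs, abs_div, abs_of_pos (stdNormal_pos _), div_eq_mul_inv]
  exact mul_le_of_le_one_left (by positivity) (stdNormal_le_one _)

theorem integrable_mul_gaussPrior {h : ℝ → ℝ} (hi : Integrable h) (k : ℝ) :
    Integrable fun μ => h μ * gaussPrior k μ := by
  simpa [gaussPrior] using integrable_mul_stdNormal hi k 0

theorem integrable_sq_mul_gaussPrior {h : ℝ → ℝ} (hi : Integrable h) {k : ℝ} (hk : 0 < k) :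
    Integrable fun μ => μ ^ 2 * (h μ * gaussPrior k μ) := by
  have : Integrable fun μ => h μ * (μ ^ 2 * gaussPrior k μ) := by
    refine hi.mul_bdd (c := 2 * k) (by fun_prop) (.of_forall fun μ => ?_)
    rw [Real.norm_of_nonneg (mul_nonneg (sq_nonneg _) (gaussPrior_pos hk μ).le)]
    calc μ ^ 2 * gaussPrior k μ = (μ / k) ^ 2 * stdNormal (μ / k) * k := by
          unfold gaussPrior; field_simp
      _ ≤ 2 * k := by gcongr; exact sq_mul_stdNormal_le_two _
  convert this using 2
  ring

theorem tendsto_integral_mul_stdNormal {h : ℝ → ℝ} (hi : Integrable h) (t : ℝ) :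
    Tendsto (fun k : ℝ => ∫ μ, h μ * stdNormal (μ / k + t)) atTop
      (𝓝 ((∫ μ, h μ) * stdNormal t)) := by
  rw [← integral_mul_const]
  refine tendsto_integral_filter_of_dominated_convergence (fun μ => ‖h μ‖)
    (.of_forall fun k => ?_) (.of_forall fun k => .of_forall fun μ => ?_) hi.norm
    (.of_forall fun μ => ?_)
  · have := hi.aestronglyMeasurable
    fun_prop
  · rw [norm_mul, Real.norm_of_nonneg (stdNormal_pos _).le]
    exact mul_le_of_le_one_right (norm_nonneg _) (stdNormal_le_one _)
  · have hlim : Tendsto (fun k : ℝ => μ / k + t) atTop (𝓝 (0 + t)) :=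
      (tendsto_const_nhds.div_atTop tendsto_id).add_const t
    rw [zero_add] at hlim
    exact ((continuous_stdNormal.tendsto t).comp hlim).const_mul _

theorem tendsto_mean_mul_stdNormal {h : ℝ → ℝ} (hi : Integrable h)
    (hi1 : Integrable fun μ => μ * h μ) (hpos : 0 < ∫ μ, h μ) (t : ℝ) :
    Tendsto (fun k : ℝ => (∫ μ, μ * (h μ * (stdNormal (μ / k + t) / k))) /
      ∫ μ, h μ * (stdNormal (μ / k + t) / k)) atTop
      (𝓝 ((∫ μ, μ * h μ) / ∫ μ, h μ)) := by
  have hlim := (tendsto_integral_mul_stdNormal hi1 t).div (tendsto_integral_mul_stdNormal hi t)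
    (mul_pos hpos (stdNormal_pos t)).ne'
  rw [mul_div_mul_right _ _ (stdNormal_pos t).ne'] at hlim
  refine hlim.congr' ?_
  filter_upwards [eventually_gt_atTop 0] with k hk
  simp only [Pi.div_apply, ← mul_assoc, ← mul_div_assoc, integral_div]
  rw [div_div_div_cancel_right₀ hk.ne']

section Location

variable {n : ℕ} {f : (Fin n → ℝ) → ℝ}

@[fun_prop]
theorem measurable_pitmanLoc (hf : Measurable f) : Measurable (pitmanLoc n f) := by
  unfold pitmanLoc
  refine Measurable.div ?_ ?_ <;>
  · refine (StronglyMeasurable.integral_prod_right (Measurable.stronglyMeasurable ?_)).measurable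
    unfold Function.uncurry
    fun_prop

@[fun_prop]
theorem measurable_bayesLoc (hf : Measurable f) (k : ℝ) : Measurable (bayesLoc n f k) := by
  unfold bayesLoc
  refine Measurable.div ?_ ?_ <;>
  · refine (StronglyMeasurable.integral_prod_right (Measurable.stronglyMeasurable ?_)).measurable
    unfold Function.uncurry
    fun_prop

theorem gaussPrior_risk_eq (hf : Measurable f) {δ : (Fin n → ℝ) → ℝ} (hδ : Measurable δ) {k : ℝ}
    (hk : 0 < k) :
    ∫⁻ x, ∫⁻ μ : ℝ, ENNReal.ofReal ((δ x - μ) ^ 2 * f (fun i => x i - μ) * gaussPrior k μ) =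
      ∫⁻ t : ℝ, ∫⁻ z, ENNReal.ofReal ((δ (fun i => z i + k * t) - k * t) ^ 2 * f z *
        stdNormal t) := by
  rw [lintegral_lintegral_swap (by unfold Function.uncurry; fun_prop),
    lintegral_eq_ofReal_mul_lintegral_comp_mul_left hk
      (Measurable.lintegral_prod_left (by unfold Function.uncurry; fun_prop))]
  refine lintegral_congr fun t => ?_
  rw [← lintegral_const_mul _ (by fun_prop),
    ← lintegral_add_right_eq_self _ (fun _ : Fin n => k * t)]
  refine lintegral_congr fun z => ?_
  rw [← ENNReal.ofReal_mul hk.le]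
  simp only [Pi.add_apply, add_sub_cancel_right, gaussPrior, mul_div_cancel_left₀ t hk.ne']
  congr 1
  have : z + (fun _ => k * t) = fun i => z i + k * t := rfl
  rw [this]
  field_simp

/-- The slice `μ ↦ f (x - μ)` has positive mass and a finite first moment. -/
def SliceRegular (f : (Fin n → ℝ) → ℝ) (x : Fin n → ℝ) : Prop :=
  Integrable (fun μ : ℝ => f (fun i => x i - μ)) ∧
    0 < (∫ μ : ℝ, f (fun i => x i - μ)) ∧
    Integrable (fun μ : ℝ => |μ| * f (fun i => x i - μ))

theorem SliceRegular.integrable_id_mul {x : Fin n → ℝ} (hx : SliceRegular f x) :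
    Integrable fun μ : ℝ => μ * f (fun i => x i - μ) :=
  integrable_id_mul_of_abs_mul hx.1.aestronglyMeasurable hx.2.2

theorem SliceRegular.pitmanLoc_add {x : Fin n → ℝ} (hx : SliceRegular f x) (c : ℝ) :
    pitmanLoc n f (fun i => x i + c) = pitmanLoc n f x + c := by
  have := mean_translate hx.1 hx.integrable_id_mul hx.2.1.ne' (-c)
  simpa [pitmanLoc, sub_add_eq_sub_sub, sub_neg_eq_add, add_sub_right_comm] using this

theorem SliceRegular.bayesLoc_add (hf0 : ∀ x, 0 ≤ f x) {z : Fin n → ℝ} (hz : SliceRegular f z)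
    {k : ℝ} (hk : 0 < k) (t : ℝ) :
    bayesLoc n f k (fun i => z i + k * t) =
      (∫ μ, μ * (f (fun i => z i - μ) * (stdNormal (μ / k + t) / k))) /
        (∫ μ, f (fun i => z i - μ) * (stdNormal (μ / k + t) / k)) + k * t := by
  have hi := integrable_mul_stdNormal hz.1 k t
  have hi1 := integrable_mul_stdNormal hz.integrable_id_mul k t
  simp only [mul_assoc] at hi1
  have := mean_translate hi hi1 (integral_mul_pos (fun μ => hf0 _) hz.2.1
    (fun μ => div_pos (stdNormal_pos _) hk) hz.1 hi).ne' (-(k * t))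
  rw [sub_neg_eq_add] at this
  rw [← this, bayesLoc]
  have hw (μ : ℝ) : f (fun i => z i + k * t - μ) * gaussPrior k μ =
      f (fun i => z i - (μ + -(k * t))) * (stdNormal ((μ + -(k * t)) / k + t) / k) := by
    have h1 : (μ + -(k * t)) / k + t = μ / k := by field_simp; ring
    have h2 : (fun i => z i + k * t - μ) = fun i => z i - (μ + -(k * t)) := by
      ext i; ring
    rw [h1, h2, gaussPrior]
  simp only [mul_assoc, hw]

theorem SliceRegular.tendsto_bayesLoc_add_sub (hf0 : ∀ x, 0 ≤ f x) {z : Fin n → ℝ}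
    (hz : SliceRegular f z) (t : ℝ) :
    Tendsto (fun k : ℝ => bayesLoc n f k (fun i => z i + k * t) - k * t) atTop
      (𝓝 (pitmanLoc n f z)) := by
  refine (tendsto_mean_mul_stdNormal hz.1 hz.integrable_id_mul hz.2.1 t).congr' ?_
  filter_upwards [eventually_gt_atTop 0] with k hk
  rw [hz.bayesLoc_add hf0 hk, add_sub_cancel_right]

theorem SliceRegular.lintegral_bayesLoc_le (hf0 : ∀ x, 0 ≤ f x) {x : Fin n → ℝ}
    (hx : SliceRegular f x) {k : ℝ} (hk : 0 < k) (a : ℝ) :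
    ∫⁻ μ : ℝ, ENNReal.ofReal ((bayesLoc n f k x - μ) ^ 2 * f (fun i => x i - μ) *
        gaussPrior k μ) ≤
      ∫⁻ μ : ℝ, ENNReal.ofReal ((a - μ) ^ 2 * f (fun i => x i - μ) * gaussPrior k μ) := by
  have hi := integrable_mul_gaussPrior hx.1 k
  have hi1 := integrable_mul_gaussPrior hx.integrable_id_mul k
  simp only [mul_assoc] at hi1
  have := lintegral_sq_mean_sub_le (fun μ => mul_nonneg (hf0 _) (gaussPrior_pos hk μ).le) hi hi1
    (integrable_sq_mul_gaussPrior hx.1 hk)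
    (integral_mul_pos (fun μ => hf0 _) hx.2.1 (gaussPrior_pos hk) hx.1 hi) a
  simpa only [bayesLoc, mul_assoc] using this

theorem lintegral_pitmanLoc_sq_mul_stdNormal (hf : Measurable f) :
    ∫⁻ t : ℝ, ∫⁻ z, ENNReal.ofReal ((pitmanLoc n f z) ^ 2 * f z * stdNormal t) =
      ∫⁻ z, ENNReal.ofReal ((pitmanLoc n f z) ^ 2 * f z) := by
  simp_rw [fun t z => ENNReal.ofReal_mul' (p := pitmanLoc n f z ^ 2 * f z) (stdNormal_pos t).le]
  rw [lintegral_congr fun t => lintegral_mul_const _ (by fun_prop),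
    lintegral_const_mul _ (by fun_prop), lintegral_stdNormal, mul_one]

end Location

/-- The Bayes risks of the posterior means under the `N(0, k²)` priors converge, as
`k → ∞`, to the constant risk `R₀` of the Pitman estimator. -/
theorem gaussian_bayes_risk_tendsto
    (n : ℕ) (f : (Fin n → ℝ) → ℝ) (hfm : Measurable f) (hf0 : ∀ x, 0 ≤ f x)
    (hf1 : ∫ x, f x = 1)
    (hae : ∀ᵐ x : Fin n → ℝ,
      Integrable (fun μ : ℝ => f (fun i => x i - μ)) ∧
      0 < (∫ μ : ℝ, f (fun i => x i - μ)) ∧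
      Integrable (fun μ : ℝ => |μ| * f (fun i => x i - μ)))
    (R₀ : ℝ≥0∞)
    (hR₀ : R₀ = ∫⁻ x, ENNReal.ofReal ((pitmanLoc n f x) ^ 2 * f x))
    (hR₀fin : R₀ < ⊤) :
    Tendsto (fun k : ℝ =>
        ∫⁻ x, ∫⁻ μ : ℝ,
          ENNReal.ofReal ((bayesLoc n f k x - μ) ^ 2 * f (fun i => x i - μ) *
            gaussPrior k μ))
      atTop (𝓝 R₀) := by
  have hreg : ∀ᵐ x, SliceRegular f x := hae
  have hR : R₀ = ∫⁻ t : ℝ, ∫⁻ z, ENNReal.ofReal ((pitmanLoc n f z) ^ 2 * f z * stdNormal t) := by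
    rw [hR₀, lintegral_pitmanLoc_sq_mul_stdNormal hfm]
  refine tendsto_of_le_liminf_of_limsup_le ?_ ?_
  · have hmeas (k : ℝ) : Measurable fun p : ℝ × (Fin n → ℝ) => ENNReal.ofReal
        ((bayesLoc n f k (fun i => p.2 i + k * p.1) - k * p.1) ^ 2 * f p.2 * stdNormal p.1) := by
      fun_prop
    calc R₀ = ∫⁻ p : ℝ × (Fin n → ℝ),
          ENNReal.ofReal ((pitmanLoc n f p.2) ^ 2 * f p.2 * stdNormal p.1) := by
          rw [hR, Measure.volume_eq_prod, lintegral_prod _ (by fun_prop)]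
      _ = ∫⁻ p : ℝ × (Fin n → ℝ), liminf (fun k : ℝ => ENNReal.ofReal
          ((bayesLoc n f k (fun i => p.2 i + k * p.1) - k * p.1) ^ 2 * f p.2 *
            stdNormal p.1)) atTop := by
          refine lintegral_congr_ae ?_
          filter_upwards [Measure.quasiMeasurePreserving_snd.ae hreg] with p hp
          exact (ENNReal.tendsto_ofReal ((((hp.tendsto_bayesLoc_add_sub hf0 p.1).pow 2).mul_const
            _).mul_const _)).liminf_eq.symm
      _ ≤ _ := lintegral_liminf_le hmeas
      _ = _ := by
          refine liminf_congr ?_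
          filter_upwards [eventually_gt_atTop 0] with k hk
          rw [gaussPrior_risk_eq hfm (measurable_bayesLoc hfm k) hk, Measure.volume_eq_prod,
            lintegral_prod _ (hmeas k).aemeasurable]
  · refine limsup_le_of_le (by isBoundedDefault) ?_
    filter_upwards [eventually_gt_atTop 0] with k hk
    calc _ ≤ ∫⁻ x, ∫⁻ μ : ℝ, ENNReal.ofReal ((pitmanLoc n f x - μ) ^ 2 *
          f (fun i => x i - μ) * gaussPrior k μ) := by
          refine lintegral_mono_ae ?_
          filter_upwards [hreg] with x hx using hx.lintegral_bayesLoc_le hf0 hk _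
      _ = R₀ := by
          rw [gaussPrior_risk_eq hfm (measurable_pitmanLoc hfm) hk, hR]
          refine lintegral_congr fun t => lintegral_congr_ae ?_
          filter_upwards [hreg] with z hz
          rw [hz.pitmanLoc_add, add_sub_cancel_right]
end

section
/- (Theorem 2.3) Suppose δ₀ : T⁺ → (p×p symmetric positive definite matrices) is measurable, equivariant (δ₀(A T) = A δ₀(T) Aᵀ for all A, T ∈ T⁺), and for every T ∈ T⁺ it minimizes the posterior loss under the prior γ(dΘ): for every symmetric positive definite p×p matrix Δ, ∫_{T⁺} L(Θ δ₀(T) Θᵀ) f_W(T | Θ) γ(dΘ) ≤ ∫_{T⁺} L(Θ Δ Θᵀ) f_W(T | Θ) γ(dΘ). Then δ₀ is best equivariant: for every measurable equivariant estimator δ and every Θ ∈ T⁺, ∫_{T⁺} L(Θ δ₀(T) Θᵀ) f_W(T | Θ) γ(dT) ≤ ∫_{T⁺} L(Θ δ(T) Θᵀ) f_W(T | Θ) γ(dT), where L is any measurable function from p×p matrices to [0,∞]. -/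
open MeasureTheory ENNReal Matrix

abbrev LowIdx (p : ℕ) := {q : Fin p × Fin p // q.2 ≤ q.1}
abbrev TriCoords (p : ℕ) := LowIdx p → ℝ

noncomputable def triMat {p : ℕ} (x : TriCoords p) : Matrix (Fin p) (Fin p) ℝ :=
  Matrix.of fun i j => if h : j ≤ i then x ⟨(i, j), h⟩ else 0

def triPos (p : ℕ) : Set (TriCoords p) :=
  {x | ∀ i : Fin p, 0 < x ⟨(i, i), le_rfl⟩}

noncomputable def gammaDens {p : ℕ} (x : TriCoords p) : ℝ≥0∞ :=
  ∏ i : Fin p, ENNReal.ofReal (x ⟨(i, i), le_rfl⟩ ^ (-((i : ℕ) + 1) : ℤ))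

noncomputable def gammaDensR {p : ℕ} (x : TriCoords p) : ℝ :=
  ∏ i : Fin p, x ⟨(i, i), le_rfl⟩ ^ (-((i : ℕ) + 1) : ℤ)

instance matrixMeasurableSpace {p : ℕ} : MeasurableSpace (Matrix (Fin p) (Fin p) ℝ) :=
  inferInstanceAs (MeasurableSpace (Fin p → Fin p → ℝ))

def memTplus {p : ℕ} (A : Matrix (Fin p) (Fin p) ℝ) : Prop :=
  (∀ i j : Fin p, i < j → A i j = 0) ∧ ∀ i : Fin p, 0 < A i i

noncomputable def wishartC (p n : ℕ) : ℝ :=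
  2 ^ ((p : ℝ) * ((n : ℝ) - 2) / 2) * Real.pi ^ ((p : ℝ) * ((p : ℝ) - 1) / 4) *
    ∏ i : Fin p, Real.Gamma (((n : ℝ) - (i : ℕ)) / 2)

noncomputable def wishartDens (p n : ℕ) (Θ T : Matrix (Fin p) (Fin p) ℝ) : ℝ :=
  (Θ * T).det ^ n * Real.exp (-(1 / 2) * ((Θ * T) * (Θ * T)ᵀ).trace) / wishartC p n

/-- Left multiplication by `A` in the coordinates of lower-triangular matrices. -/
noncomputable def triMulLeft {p : ℕ} (A : Matrix (Fin p) (Fin p) ℝ) :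
    TriCoords p →ₗ[ℝ] TriCoords p where
  toFun x q := (A * triMat x) q.1.1 q.1.2
  map_add' x y := by
    have h : triMat (x + y) = triMat x + triMat y := by
      ext i j
      by_cases hij : j ≤ i <;> simp [triMat, hij]
    ext q
    simp [h, Matrix.mul_add]
  map_smul' c x := by
    have h : triMat (c • x) = c • triMat x := by
      ext i j
      by_cases hij : j ≤ i <;> simp [triMat, hij]
    ext q
    simp [h]

theorem triMulLeft_apply {p : ℕ} (A : Matrix (Fin p) (Fin p) ℝ) (x : TriCoords p)
    (q : LowIdx p) : triMulLeft A x q = (A * triMat x) q.1.1 q.1.2 := rfl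

theorem triMat_triMulLeft {p : ℕ} {A : Matrix (Fin p) (Fin p) ℝ} (hA : memTplus A)
    (x : TriCoords p) : triMat (triMulLeft A x) = A * triMat x := by
  ext i j
  by_cases hij : j ≤ i
  · simp [triMat, hij, triMulLeft_apply]
  · have : (A * triMat x) i j = 0 := by
      rw [Matrix.mul_apply]
      refine Finset.sum_eq_zero fun k _ => ?_
      rcases lt_or_ge i k with h | h
      · simp [hA.1 i k h]
      · have hjk : ¬ j ≤ k := fun h' => hij (h'.trans h)
        simp [triMat, hjk]
    rw [this]
    simp [triMat, hij]

theorem triMulLeft_diag {p : ℕ} {A : Matrix (Fin p) (Fin p) ℝ} (hA : memTplus A)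
    (x : TriCoords p) (i : Fin p) :
    triMulLeft A x ⟨(i, i), le_rfl⟩ = A i i * x ⟨(i, i), le_rfl⟩ := by
  rw [triMulLeft_apply, Matrix.mul_apply, Finset.sum_eq_single i]
  · simp [triMat]
  · intro k _ hk
    rcases lt_or_gt_of_ne hk with h | h
    · simp [triMat, not_le.mpr h]
    · simp [hA.1 i k h]
  · simp

theorem triMulLeft_toMatrix {p : ℕ} (A : Matrix (Fin p) (Fin p) ℝ) (q r : LowIdx p) :
    LinearMap.toMatrix' (triMulLeft A) q r =
      if r.1.2 = q.1.2 then A q.1.1 r.1.1 else 0 := by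
  obtain ⟨⟨i, j⟩, hij⟩ := q
  obtain ⟨⟨k, l⟩, hkl⟩ := r
  rw [LinearMap.toMatrix'_apply, triMulLeft_apply, Matrix.mul_apply,
    Finset.sum_eq_single k]
  · by_cases h : l = j
    · subst h
      simp [triMat, show l ≤ k from hkl]
    · by_cases h' : j ≤ k <;> simp [triMat, h, h', Ne.symm h, Pi.single_apply]
  · intro m _ hm
    by_cases h' : j ≤ m <;> simp [triMat, h', hm, Pi.single_apply]
  · simp

theorem card_row {p : ℕ} (i : Fin p) :
    Fintype.card {q : LowIdx p // q.1.1 = i} = (i : ℕ) + 1 := by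
  rw [← Fin.card_Iic i, ← Fintype.card_coe]
  refine Fintype.card_congr
    { toFun := fun q => ⟨q.1.1.2, Finset.mem_Iic.mpr (q.1.2.trans_eq q.2)⟩
      invFun := fun j => ⟨⟨(i, j.1), Finset.mem_Iic.mp j.2⟩, rfl⟩
      left_inv := ?_
      right_inv := fun _ => rfl }
  rintro ⟨⟨⟨k, l⟩, h⟩, rfl⟩
  rfl

theorem det_triMulLeft {p : ℕ} {A : Matrix (Fin p) (Fin p) ℝ} (hA : memTplus A) :
    LinearMap.det (triMulLeft A) = ∏ i : Fin p, A i i ^ ((i : ℕ) + 1) := by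
  rw [← LinearMap.det_toMatrix', ← Matrix.det_transpose]
  have hbt : (LinearMap.toMatrix' (triMulLeft A))ᵀ.BlockTriangular
      fun q : LowIdx p => q.1.1 := by
    intro q r h
    rw [Matrix.transpose_apply, triMulLeft_toMatrix, hA.1 _ _ h, ite_self]
  rw [hbt.det_fintype]
  refine Finset.prod_congr rfl fun i _ => ?_
  have hblock : (LinearMap.toMatrix' (triMulLeft A))ᵀ.toSquareBlock
      (fun q : LowIdx p => q.1.1) i = A i i • (1 : Matrix _ _ ℝ) := by
    ext ⟨⟨⟨k, l⟩, hkl⟩, hk⟩ ⟨⟨⟨k', l'⟩, hkl'⟩, hk'⟩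
    obtain rfl : k = i := hk
    obtain rfl : k' = k := hk'
    rw [Matrix.toSquareBlock_def, Matrix.of_apply, Matrix.transpose_apply, triMulLeft_toMatrix]
    simp [Matrix.one_apply]
  rw [hblock, Matrix.det_smul, Matrix.det_one, mul_one, card_row]

theorem det_triMulLeft_pos {p : ℕ} {A : Matrix (Fin p) (Fin p) ℝ} (hA : memTplus A) :
    0 < LinearMap.det (triMulLeft A) := by
  rw [det_triMulLeft hA]
  exact Finset.prod_pos fun i _ => pow_pos (hA.2 i) _

theorem triMulLeft_image_triPos {p : ℕ} {A : Matrix (Fin p) (Fin p) ℝ} (hA : memTplus A) :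
    triMulLeft A '' triPos p = triPos p := by
  ext x
  constructor
  · rintro ⟨y, hy, rfl⟩ i
    rw [triMulLeft_diag hA]
    exact mul_pos (hA.2 i) (hy i)
  · intro hx
    obtain ⟨y, rfl⟩ := (LinearMap.equivOfDetNeZero _ (det_triMulLeft_pos hA).ne').surjective x
    refine ⟨y, fun i => ?_, rfl⟩
    have h : 0 < triMulLeft A y ⟨(i, i), le_rfl⟩ := hx i
    rw [triMulLeft_diag hA] at h
    exact (pos_iff_pos_of_mul_pos h).mp (hA.2 i)

theorem measurableSet_triPos (p : ℕ) : MeasurableSet (triPos p) := by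
  rw [triPos, Set.ofPred_forall]
  exact MeasurableSet.iInter fun i => measurableSet_lt measurable_const (measurable_pi_apply _)

theorem det_mul_gammaDens_triMulLeft {p : ℕ} {A : Matrix (Fin p) (Fin p) ℝ}
    (hA : memTplus A) (x : TriCoords p) :
    ENNReal.ofReal |LinearMap.det (triMulLeft A)| * gammaDens (triMulLeft A x) =
      gammaDens x := by
  rw [abs_of_pos (det_triMulLeft_pos hA), det_triMulLeft hA,
    ENNReal.ofReal_prod_of_nonneg fun i _ => (pow_pos (hA.2 i) _).le, gammaDens, gammaDens,
    ← Finset.prod_mul_distrib]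
  refine Finset.prod_congr rfl fun i _ => ?_
  have hi := hA.2 i
  rw [← ENNReal.ofReal_mul (pow_pos hi _).le, triMulLeft_diag hA, mul_zpow, ← mul_assoc,
    ← zpow_natCast, ← zpow_add₀ hi.ne']
  simp

/-- The measure `γ` on `T⁺` is invariant under left multiplication. -/
theorem lintegral_mul_left_gammaDens {p : ℕ} {A : Matrix (Fin p) (Fin p) ℝ}
    (hA : memTplus A) (g : Matrix (Fin p) (Fin p) ℝ → ℝ≥0∞) :
    ∫⁻ x in triPos p, g (A * triMat x) * gammaDens x =
      ∫⁻ x in triPos p, g (triMat x) * gammaDens x := by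
  have hinj : Function.Injective (triMulLeft A) :=
    (LinearMap.equivOfDetNeZero _ (det_triMulLeft_pos hA).ne').injective
  have hcov := lintegral_image_eq_lintegral_abs_det_fderiv_mul volume
    (measurableSet_triPos p)
    (fun x _ => (triMulLeft A).toContinuousLinearMap.hasFDerivWithinAt (x := x))
    hinj.injOn (fun x => g (triMat x) * gammaDens x)
  rw [LinearMap.coe_toContinuousLinearMap', triMulLeft_image_triPos hA] at hcov
  rw [hcov]
  refine lintegral_congr fun x => ?_
  rw [LinearMap.det_toContinuousLinearMap, triMat_triMulLeft hA, mul_left_comm,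
    det_mul_gammaDens_triMulLeft hA]

theorem memTplus_one (p : ℕ) : memTplus (1 : Matrix (Fin p) (Fin p) ℝ) :=
  ⟨fun _ _ h => Matrix.one_apply_ne h.ne, fun _ => by simp⟩

theorem memTplus_triMat {p : ℕ} {x : TriCoords p} (hx : x ∈ triPos p) :
    memTplus (triMat x) :=
  ⟨fun _ _ h => by simp [triMat, not_le.mpr h], fun i => by simpa [triMat] using hx i⟩

/-- The risk of an equivariant estimator `δ` is, at every parameter value, the posterior loss
of the constant `δ 1` given the observation `1`. -/
theorem equivariant_risk_eq_posterior_loss {p n : ℕ}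
    (L : Matrix (Fin p) (Fin p) ℝ → ℝ≥0∞)
    {δ : Matrix (Fin p) (Fin p) ℝ → Matrix (Fin p) (Fin p) ℝ}
    (hδ : ∀ A T, memTplus A → memTplus T → δ (A * T) = A * δ T * Aᵀ)
    {Θ : Matrix (Fin p) (Fin p) ℝ} (hΘ : memTplus Θ) :
    ∫⁻ x in triPos p,
        L (Θ * δ (triMat x) * Θᵀ) * ENNReal.ofReal (wishartDens p n Θ (triMat x)) *
          gammaDens x =
      ∫⁻ y in triPos p,
        L (triMat y * δ 1 * (triMat y)ᵀ) * ENNReal.ofReal (wishartDens p n (triMat y) 1) *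
          gammaDens y := by
  rw [← lintegral_mul_left_gammaDens hΘ fun M =>
    L (M * δ 1 * Mᵀ) * ENNReal.ofReal (wishartDens p n M 1)]
  refine setLIntegral_congr_fun (measurableSet_triPos p) fun x hx => ?_
  have h := hδ (triMat x) 1 (memTplus_triMat hx) (memTplus_one p)
  rw [Matrix.mul_one] at h
  simp only [h, wishartDens, Matrix.mul_one, Matrix.transpose_mul, Matrix.mul_assoc]

/-- (Theorem 2.3) If a measurable equivariant estimator `δ₀` minimizes, for every
`T ∈ T⁺`, the posterior loss under the prior `γ(dΘ)`, then it is best equivariant: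
its risk is no larger than that of any measurable equivariant estimator, at every
parameter value. -/
theorem wishart_best_equivariant
    (p n : ℕ) (hp : 1 ≤ p) (hn : p ≤ n)
    (L : Matrix (Fin p) (Fin p) ℝ → ℝ≥0∞) (hL : Measurable L)
    (δ₀ : Matrix (Fin p) (Fin p) ℝ → Matrix (Fin p) (Fin p) ℝ) (hδ₀m : Measurable δ₀)
    (hδ₀pd : ∀ T, memTplus T → (δ₀ T).PosDef)
    (hδ₀eq : ∀ A T, memTplus A → memTplus T → δ₀ (A * T) = A * δ₀ T * Aᵀ)
    (hmin : ∀ T : Matrix (Fin p) (Fin p) ℝ, memTplus T →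
      ∀ Δ : Matrix (Fin p) (Fin p) ℝ, Δ.PosDef →
        ∫⁻ y in triPos p,
            L (triMat y * δ₀ T * (triMat y)ᵀ) *
              ENNReal.ofReal (wishartDens p n (triMat y) T) * gammaDens y ≤
          ∫⁻ y in triPos p,
            L (triMat y * Δ * (triMat y)ᵀ) *
              ENNReal.ofReal (wishartDens p n (triMat y) T) * gammaDens y) :
    ∀ δ : Matrix (Fin p) (Fin p) ℝ → Matrix (Fin p) (Fin p) ℝ, Measurable δ →
      (∀ T, memTplus T → (δ T).PosDef) →
      (∀ A T, memTplus A → memTplus T → δ (A * T) = A * δ T * Aᵀ) →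
      ∀ Θ : Matrix (Fin p) (Fin p) ℝ, memTplus Θ →
        ∫⁻ x in triPos p,
            L (Θ * δ₀ (triMat x) * Θᵀ) * ENNReal.ofReal (wishartDens p n Θ (triMat x)) *
              gammaDens x ≤
          ∫⁻ x in triPos p,
            L (Θ * δ (triMat x) * Θᵀ) * ENNReal.ofReal (wishartDens p n Θ (triMat x)) *
              gammaDens x := by
  intro δ _ hδpd hδeq Θ hΘ
  rw [equivariant_risk_eq_posterior_loss L hδ₀eq hΘ,
    equivariant_risk_eq_posterior_loss L hδeq hΘ]
  exact hmin 1 (memTplus_one p) (δ 1) (hδpd 1 (memTplus_one p))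
end
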